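/- arXiv:2002.03539 — 2 statements merged into one kernel-verified Lean document; each statement's English description precedes it below -/
import Mathlib

section
/- For every 3-regular bipartite graph G, the edge set of G can be partitioned into two sets A1 and A2 such that both spanning subgraphs (V(G), A1) and (V(G), A2) are disjoint unions of paths (i.e., every vertex has degree at most 2 and there are no cycles). -/
/-- A graph is a disjoint union of paths iff it is acyclic and every vertex has
degree at most 2. -/
def IsPathForest {V : Type*} (H : SimpleGraph V) : Prop :=
  H.IsAcyclic ∧ ∀ v : V, (H.neighborSet v).ncard ≤ 2

namespace SimpleGraph

variable {V : Type*} {G : SimpleGraph V}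

/-- Every vertex of a cycle has at least two neighbours. -/
lemma Walk.IsCycle.exists_ne_adj {u v : V} {c : G.Walk u u} (hc : c.IsCycle)
    (hv : v ∈ c.support) :
    ∃ a ∈ c.support, ∃ b ∈ c.support, a ≠ b ∧ G.Adj v a ∧ G.Adj v b := by
  obtain ⟨a, b, hab, h⟩ := Set.ncard_eq_two.mp (hc.ncard_neighborSet_toSubgraph_eq_two hv)
  have ha : c.toSubgraph.Adj v a := by
    rw [← Subgraph.mem_neighborSet, h]; simp
  have hb : c.toSubgraph.Adj v b := by
    rw [← Subgraph.mem_neighborSet, h]; simp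
  exact ⟨a, c.mem_verts_toSubgraph.mp ha.snd_mem, b, c.mem_verts_toSubgraph.mp hb.snd_mem,
    hab, ha.adj_sub, hb.adj_sub⟩

variable [Finite V]

/-- A graph of maximum degree at most one is acyclic. -/
lemma isAcyclic_of_ncard_neighborSet_le_one (h : ∀ v, (G.neighborSet v).ncard ≤ 1) :
    G.IsAcyclic := by
  intro v c hc
  obtain ⟨a, -, b, -, hab, ha, hb⟩ := hc.exists_ne_adj c.start_mem_support
  exact hab ((Set.ncard_le_one (Set.toFinite _)).mp (h v) a ha b hb)

/-- In a graph of maximum degree at most two, two paths starting at the same leaf agree for as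
long as both are defined. -/
lemma Walk.IsPath.getVert_eq_getVert (hdeg : ∀ v, (G.neighborSet v).ncard ≤ 2) {u v w : V}
    (hu : (G.neighborSet u).ncard ≤ 1) {p : G.Walk u v} {q : G.Walk u w}
    (hp : p.IsPath) (hq : q.IsPath) :
    ∀ i, i ≤ p.length → i ≤ q.length → p.getVert i = q.getVert i
  | 0, _, _ => by simp
  | 1, hip, hiq => by
    have ha := p.adj_getVert_succ (i := 0) (by lia)
    have hb := q.adj_getVert_succ (i := 0) (by lia)
    rw [getVert_zero] at ha hb
    exact (Set.ncard_le_one (Set.toFinite _)).mp hu _ ha _ hb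
  | i + 2, hip, hiq => by
    have h₀ := getVert_eq_getVert hdeg hu hp hq i (by lia) (by lia)
    have h₁ := getVert_eq_getVert hdeg hu hp hq (i + 1) (by lia) (by lia)
    have hpa := p.adj_getVert_succ (i := i) (by lia)
    have hpb := p.adj_getVert_succ (i := i + 1) (by lia)
    have hqb := q.adj_getVert_succ (i := i + 1) (by lia)
    have hpn : p.getVert i ≠ p.getVert (i + 2) := fun h ↦ by
      have := hp.getVert_injOn (by simp; lia) (by simp; lia) h
      lia
    have hqn : q.getVert i ≠ q.getVert (i + 2) := fun h ↦ by
      have := hq.getVert_injOn (by simp; lia) (by simp; lia) h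
      lia
    by_contra hne
    refine (hdeg (p.getVert (i + 1))).not_gt ((Set.two_lt_ncard_iff (Set.toFinite _)).mpr
      ⟨p.getVert i, p.getVert (i + 2), q.getVert (i + 2), hpa.symm, hpb, ?_, hpn, ?_, hne⟩)
    · rw [h₁]; exact hqb
    · rw [h₀]; exact hqn

/-- In a graph of maximum degree at most two, a component has at most two leaves. -/
lemma Reachable.eq_of_ncard_neighborSet_le_one (hdeg : ∀ v, (G.neighborSet v).ncard ≤ 2)
    {u v w : V} (hu : (G.neighborSet u).ncard ≤ 1) (hv : (G.neighborSet v).ncard ≤ 1)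
    (hw : (G.neighborSet w).ncard ≤ 1) (huv : G.Reachable u v) (huw : G.Reachable u w)
    (hneuv : u ≠ v) (hneuw : u ≠ w) : v = w := by
  obtain ⟨p, hp⟩ := huv.exists_isPath
  obtain ⟨q, hq⟩ := huw.exists_isPath
  wlog hle : p.length ≤ q.length generalizing v w
  · exact (this hw hv huw huv hneuw hneuv q hq p hp (by lia)).symm
  have heq := hp.getVert_eq_getVert hdeg hu hq p.length le_rfl hle
  rw [Walk.getVert_length] at heq
  rcases hle.eq_or_lt with h | hlt
  · rw [heq, h, Walk.getVert_length]
  have hpos : 0 < p.length := by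
    by_contra h
    exact hneuv (Walk.eq_of_length_eq_zero (p := p) (by lia))
  obtain ⟨i, hi⟩ : ∃ i, p.length = i + 1 := ⟨p.length - 1, by lia⟩
  rw [hi] at heq
  have ha := q.adj_getVert_succ (i := i) (by lia)
  have hb := q.adj_getVert_succ (i := i + 1) (by lia)
  rw [← heq] at ha hb
  have := hq.getVert_injOn (by simp; lia) (by simp; lia)
    ((Set.ncard_le_one (Set.toFinite _)).mp hv _ ha.symm _ hb)
  lia

/-- A regular bipartite graph of positive degree has a perfect matching. -/
lemma exists_isPerfectMatching_of_ncard_neighborSet_eq {k : ℕ} (hk : 0 < k)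
    (hreg : ∀ v, (G.neighborSet v).ncard = k) (hbip : G.IsBipartite) :
    ∃ M : G.Subgraph, M.IsPerfectMatching := by
  classical
  have := Fintype.ofFinite V
  obtain ⟨s, t, hst⟩ := hbip.exists_isBipartiteWith
  have hcard (v : V) : (G.neighborFinset v).card = k := by
    rw [← hreg v, ← Set.ncard_coe_finset, coe_neighborFinset]
  refine exists_isPerfectMatching_of_forall_ncard_le hst fun A ↦ ?_
  set B := ⋃ x ∈ A, G.neighborSet x
  rw [Set.ncard_eq_toFinset_card', Set.ncard_eq_toFinset_card']
  refine Nat.le_of_mul_le_mul_right (Finset.card_mul_le_card_mul G.Adj (m := k) (n := k)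
    (fun a ha ↦ ?_) fun b _ ↦ ?_) hk
  · rw [← hcard a]
    refine Finset.card_le_card fun b hb ↦ ?_
    rw [mem_neighborFinset] at hb
    rw [Finset.mem_bipartiteAbove, Set.mem_toFinset]
    exact ⟨Set.mem_biUnion (Set.mem_toFinset.mp ha) hb, hb⟩
  · rw [← hcard b]
    refine Finset.card_le_card fun a ha ↦ ?_
    rw [mem_neighborFinset]
    exact ((Finset.mem_bipartiteBelow _).mp ha).2.symm

lemma ncard_neighborSet_sup_edge_le {v : V} (u w : V) :
    ((G ⊔ edge u w).neighborSet v).ncard ≤ (G.neighborSet v).ncard + 1 := by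
  classical
  by_cases hv : v = u
  · refine (Set.ncard_le_ncard (t := insert w (G.neighborSet v)) ?_).trans (Set.ncard_insert_le _ _)
    intro x hx
    simp only [mem_neighborSet, sup_adj, edge_adj, Set.mem_insert_iff] at hx ⊢
    grind
  · refine (Set.ncard_le_ncard (t := insert u (G.neighborSet v)) ?_).trans (Set.ncard_insert_le _ _)
    intro x hx
    simp only [mem_neighborSet, sup_adj, edge_adj, Set.mem_insert_iff] at hx ⊢
    grind

lemma ncard_neighborSet_add_ncard_neighborSet_sdiff {H : SimpleGraph V} (h : H ≤ G) (v : V) :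
    (H.neighborSet v).ncard + ((G \ H).neighborSet v).ncard = (G.neighborSet v).ncard := by
  have : (G \ H).neighborSet v = G.neighborSet v \ H.neighborSet v := by
    ext; simp
  rw [this, add_comm]
  exact Set.ncard_sdiff_add_ncard_of_subset fun x hx ↦ h hx

end SimpleGraph

open SimpleGraph

/-- The edge set of every 3-regular bipartite graph can be partitioned into two
parts, each of which forms a spanning subgraph that is a disjoint union of paths. -/
theorem stmt1 {V : Type*} [Fintype V] (G : SimpleGraph V)
    (hreg : ∀ v : V, (G.neighborSet v).ncard = 3)
    (hbip : G.Colorable 2) :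
    ∃ H1 H2 : SimpleGraph V,
      H1 ⊔ H2 = G ∧ Disjoint H1 H2 ∧ IsPathForest H1 ∧ IsPathForest H2 := by
  obtain ⟨M, hM⟩ := exists_isPerfectMatching_of_ncard_neighborSet_eq three_pos hreg hbip
  have hM1 (v : V) : (M.spanningCoe.neighborSet v).ncard = 1 := by
    obtain ⟨w, hw, huniq⟩ := Subgraph.isPerfectMatching_iff.mp hM v
    refine Set.ncard_eq_one.mpr ⟨w, Set.eq_singleton_iff_unique_mem.mpr ⟨hw, huniq⟩⟩
  -- Take a maximal path forest between the matching and the graph.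
  obtain ⟨H, ⟨hMH, hHG, hac, hdeg⟩, hmax⟩ :=
    (Set.toFinite {H : SimpleGraph V | M.spanningCoe ≤ H ∧ H ≤ G ∧ IsPathForest H}).exists_maximal
      ⟨M.spanningCoe, le_rfl, M.spanningCoe_le,
        isAcyclic_of_ncard_neighborSet_le_one fun v ↦ (hM1 v).le,
        fun v ↦ (hM1 v).le.trans one_le_two⟩
  have hsum (v : V) := (ncard_neighborSet_add_ncard_neighborSet_sdiff hHG v).trans (hreg v)
  have hpos (v : V) : 1 ≤ (H.neighborSet v).ncard :=
    (hM1 v).ge.trans (Set.ncard_le_ncard fun x hx ↦ hMH hx)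
  refine ⟨H, G \ H, sup_sdiff_cancel_right hHG, disjoint_sdiff_self_right, ⟨hac, hdeg⟩, ?_,
    fun v ↦ by have := hsum v; have := hpos v; lia⟩
  intro v c hc
  have hleaf {x : V} (hx : x ∈ c.support) : (H.neighborSet x).ncard ≤ 1 := by
    obtain ⟨a, -, b, -, hab, ha, hb⟩ := hc.exists_ne_adj hx
    have : 1 < ((G \ H).neighborSet x).ncard :=
      (Set.one_lt_ncard (Set.toFinite _)).mpr ⟨a, ha, b, hb, hab⟩
    have := hsum x
    lia
  have hreach {x y : V} (hx : x ∈ c.support) (hy : y ∈ c.support) (hxy : (G \ H).Adj x y) :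
      H.Reachable x y := by
    by_contra hn
    have hle : H ⊔ edge x y ≤ H := hmax
      ⟨hMH.trans le_sup_left, sup_le hHG ((edge_le_iff _).mpr (Or.inr hxy.1)),
        hac.sup_edge_of_not_reachable hn, fun z ↦ ?_⟩ le_sup_left
    · exact hxy.2 (hle (Or.inr ((edge_adj ..).mpr ⟨Or.inl ⟨rfl, rfl⟩, hxy.ne⟩)))
    by_cases hz : (H.neighborSet z).ncard ≤ 1
    · exact (ncard_neighborSet_sup_edge_le x y).trans (by lia)
    · have hzx : z ≠ x := by rintro rfl; exact hz (hleaf hx)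
      have hzy : z ≠ y := by rintro rfl; exact hz (hleaf hy)
      refine (Set.ncard_le_ncard fun w hw ↦ ?_).trans (hdeg z)
      simpa [edge_adj, hzx, hzy] using hw
  obtain ⟨a, has, b, hbs, hab, ha, hb⟩ := hc.exists_ne_adj c.start_mem_support
  exact hab ((hreach c.start_mem_support has ha).eq_of_ncard_neighborSet_le_one hdeg
    (hleaf c.start_mem_support) (hleaf has) (hleaf hbs) (hreach c.start_mem_support hbs hb)
    ha.ne hb.ne)
end

section
/- A finite election (C, Π) of linear orders is single-peaked (with respect to some axis) if and only if it contains neither a worst-diverse structure nor an α-structure. -/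
/-- Single-peakedness of a vote `v` with respect to an axis `ax`
(`lt x y` means `x` is ranked above `y`). -/
def SinglePeaked {C : Type*} (ax v : LinearOrder C) : Prop :=
  ∀ a b c : C, ((ax.lt a b ∧ ax.lt b c) ∨ (ax.lt c b ∧ ax.lt b a)) →
    v.lt c b → v.lt b a

/-- The election `E` is single-peaked with respect to some axis. -/
def ElectionSP {C : Type*} (E : Multiset (LinearOrder C)) : Prop :=
  ∃ ax : LinearOrder C, ∀ v ∈ E, SinglePeaked ax v

/-- The election contains a worst-diverse structure: three votes and three
candidates each of which is ranked below the other two in one of the votes. -/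
def HasWD {C : Type*} (E : Multiset (LinearOrder C)) : Prop :=
  ∃ πx ∈ E, ∃ πy ∈ E, ∃ πz ∈ E, ∃ a b c : C,
    πx.lt b a ∧ πx.lt c a ∧ πy.lt a b ∧ πy.lt c b ∧ πz.lt a c ∧ πz.lt b c

/-- The election contains an α-structure. -/
def HasAlpha {C : Type*} (E : Multiset (LinearOrder C)) : Prop :=
  ∃ πx ∈ E, ∃ πy ∈ E, ∃ a b c d : C,
    πx.lt a b ∧ πx.lt b c ∧ πx.lt d b ∧ πy.lt c b ∧ πy.lt b a ∧ πy.lt d b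

/-- A partial assignment of parities to the pairs `x < y` of a finite linear order is induced by a
two-colouring as soon as it is single-valued, consistent on triangles, and each vertex has pairwise
related upper neighbours. -/
theorem exists_coloring_of_parity {α : Type*} [LinearOrder α] [Finite α]
    (R : α → α → Bool → Prop)
    (unique : ∀ x y p q, x < y → R x y p → R x y q → p = q)
    (chord : ∀ x y z p q, x < y → y < z → R x y p → R x z q → ∃ r, R y z r)
    (triangle : ∀ x y z p q r, x < y → y < z → R x y p → R x z q → R y z r → q = xor p r) :
    ∃ s : α → Bool, ∀ x y p, x < y → R x y p → s x = xor p (s y) := by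
  classical
  let F : (x : α) → ((y : α) → y > x → Bool) → Bool :=
    fun x ih => decide (∃ y, ∃ h : y > x, ∃ p, R x y p ∧ xor p (ih y h) = true)
  have wf : WellFounded (fun y x : α => y > x) := wellFounded_gt
  let s : α → Bool := wf.fix F
  have hs : ∀ x, s x = true ↔ ∃ y, x < y ∧ ∃ p, R x y p ∧ xor p (s y) = true := by
    intro x
    have h := wf.fix_eq F x
    change s x = decide (∃ y, ∃ _ : y > x, ∃ p, R x y p ∧ xor p (s y) = true) at h
    rw [h, decide_eq_true_iff]
    simp only [exists_prop, gt_iff_lt]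
  refine ⟨s, fun x => ?_⟩
  induction x using wf.induction with
  | _ x ih =>
    intro y p hxy hR
    cases hp : xor p (s y) with
    | true => exact (hs x).2 ⟨y, hxy, p, hR, hp⟩
    | false =>
      rw [Bool.eq_false_iff]
      intro hx
      obtain ⟨z, hxz, q, hR', hq⟩ := (hs x).1 hx
      rcases lt_trichotomy y z with hyz | rfl | hzy
      · obtain ⟨r, hr⟩ := chord x y z p q hxy hyz hR hR'
        have h1 := ih y hxy z r hyz hr
        have h2 := triangle x y z p q r hxy hyz hR hR' hr
        grind
      · have := unique x y p q hxy hR hR'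
        grind
      · obtain ⟨r, hr⟩ := chord x z y q p hxz hzy hR' hR
        have h1 := ih z hxz y r hzy hr
        have h2 := triangle x z y q p r hxz hzy hR' hR hr
        grind

/-- Candidates `x` above `y` in `v₀` have to lie on opposite sides of the peak of `v₀`. -/
def ForcedOpposite {C : Type*} (E : Multiset (LinearOrder C)) (v₀ : LinearOrder C) (x y : C) :
    Prop :=
  ∃ a, v₀.lt a x ∧ ∃ v ∈ E, v.lt a x ∧ v.lt y x

/-- Candidates `x` above `y` in `v₀` have to lie on the same side of the peak of `v₀`. -/
def ForcedSame {C : Type*} (E : Multiset (LinearOrder C)) (v₀ : LinearOrder C) (x y : C) :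
    Prop :=
  ∃ a, v₀.lt a x ∧ ∃ v ∈ E, v.lt x a ∧ v.lt y a

section Forced

variable {C : Type*} {E : Multiset (LinearOrder C)} {v₀ : LinearOrder C}

theorem LinearOrder.lt_or_lt_of_ranked (v w : LinearOrder C) {a b : C} (h : w.lt a b) :
    v.lt a b ∨ v.lt b a := by
  have hne : a ≠ b := @ne_of_lt C w.toPreorder a b h
  exact @lt_or_gt_of_ne C v a b hne

theorem LinearOrder.ranked_trans (v : LinearOrder C) {a b c : C} (h : v.lt a b) (h' : v.lt b c) :
    v.lt a c :=
  @lt_trans C v.toPreorder a b c h h'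

theorem LinearOrder.ranked_asymm (v : LinearOrder C) {a b : C} (h : v.lt a b) : ¬ v.lt b a :=
  @lt_asymm C v.toPreorder a b h

theorem not_forcedOpposite_and_forcedSame (hv₀ : v₀ ∈ E) (hW : ¬ HasWD E) (hA : ¬ HasAlpha E)
    {x y : C} (hxy : v₀.lt x y) (hO : ForcedOpposite E v₀ x y) : ¬ ForcedSame E v₀ x y := by
  obtain ⟨d, hd, π, hπ, h1, h2⟩ := hO
  rintro ⟨a, ha, ρ, hρ, h3, h4⟩
  rcases π.lt_or_lt_of_ranked v₀ ha with h | h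
  · exact hW ⟨ρ, hρ, π, hπ, v₀, hv₀, a, x, y, h3, h4, h, h2, v₀.ranked_trans ha hxy, hxy⟩
  · exact hA ⟨v₀, hv₀, π, hπ, a, x, y, d, ha, hxy, hd, h2, h, h1⟩

theorem forced_of_forced {x y z : C} (hxy : v₀.lt x y)
    (h : ForcedOpposite E v₀ x z ∨ ForcedSame E v₀ x z) :
    ForcedOpposite E v₀ y z ∨ ForcedSame E v₀ y z := by
  rcases h with ⟨a, ha, v, hv, h1, h2⟩ | ⟨a, ha, v, hv, h1, h2⟩
  · rcases v.lt_or_lt_of_ranked v₀ hxy with h | h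
    · exact .inl ⟨x, hxy, v, hv, h, v.ranked_trans h2 h⟩
    · exact .inr ⟨x, hxy, v, hv, h, h2⟩
  · have hay := v₀.ranked_trans ha hxy
    rcases v.lt_or_lt_of_ranked v₀ hay with h | h
    · exact .inl ⟨a, hay, v, hv, h, v.ranked_trans h2 h⟩
    · exact .inr ⟨a, hay, v, hv, h, h2⟩

theorem not_forcedOpposite_triangle (hv₀ : v₀ ∈ E) (hW : ¬ HasWD E) (hA : ¬ HasAlpha E)
    {c d e : C} (hcd : v₀.lt c d) (hde : v₀.lt d e) (h1 : ForcedOpposite E v₀ c d)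
    (h2 : ForcedOpposite E v₀ c e) : ¬ ForcedOpposite E v₀ d e := by
  intro h3
  have hce := v₀.ranked_trans hcd hde
  have n2 := not_forcedOpposite_and_forcedSame hv₀ hW hA hce h2
  have n3 := not_forcedOpposite_and_forcedSame hv₀ hW hA hde h3
  obtain ⟨a, ha, π, hπ, hac, hdc⟩ := h1
  obtain ⟨b, hb, ρ, hρ, hbc, hec⟩ := h2
  rcases π.lt_or_lt_of_ranked v₀ hce with hce' | hec'
  · rcases ρ.lt_or_lt_of_ranked v₀ hcd with hcd' | hdc'
    · rcases ρ.lt_or_lt_of_ranked v₀ ha with hac' | hca'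
      · exact hA ⟨π, hπ, ρ, hρ, d, c, e, a, hdc, hce', hac, hec, hcd', hac'⟩
      · exact n2 ⟨a, ha, ρ, hρ, hca', ρ.ranked_trans hec hca'⟩
    · exact n3 ⟨c, hcd, ρ, hρ, hdc', hec⟩
  · exact n3 ⟨c, hcd, π, hπ, hdc, hec'⟩

theorem not_forcedOpposite_of_forcedSame_of_forcedSame (hv₀ : v₀ ∈ E) (hW : ¬ HasWD E)
    (hA : ¬ HasAlpha E) {c d e : C} (hcd : v₀.lt c d) (hde : v₀.lt d e)
    (h1 : ForcedSame E v₀ c d) (h2 : ForcedSame E v₀ c e) : ¬ ForcedOpposite E v₀ d e := by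
  intro h3
  have hce := v₀.ranked_trans hcd hde
  have n1 := fun h => not_forcedOpposite_and_forcedSame hv₀ hW hA hcd h h1
  have n2 := fun h => not_forcedOpposite_and_forcedSame hv₀ hW hA hce h h2
  have n3 := not_forcedOpposite_and_forcedSame hv₀ hW hA hde h3
  obtain ⟨a, ha, π, hπ, hca, hda⟩ := h1
  obtain ⟨b, hb, ρ, hρ, hcb, heb⟩ := h2
  have had := v₀.ranked_trans ha hcd
  have hbd := v₀.ranked_trans hb hcd
  have hae := v₀.ranked_trans had hde
  have hbe := v₀.ranked_trans hbd hde
  have hae' : π.lt a e := (π.lt_or_lt_of_ranked v₀ hae).resolve_right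
    fun h => n3 ⟨a, had, π, hπ, hda, h⟩
  have hbd' : ρ.lt b d := (ρ.lt_or_lt_of_ranked v₀ hbd).resolve_right
    fun h => n3 ⟨b, hbd, ρ, hρ, h, heb⟩
  have hρae : ρ.lt a e := by
    refine (ρ.lt_or_lt_of_ranked v₀ hae).resolve_right fun h => ?_
    rcases ρ.lt_or_lt_of_ranked v₀ ha with hac | hca'
    · exact n2 ⟨a, ha, ρ, hρ, hac, ρ.ranked_trans h hac⟩
    · rcases ρ.lt_or_lt_of_ranked v₀ had with had' | hda'
      · exact hA ⟨π, hπ, ρ, hρ, d, a, e, c, hda, hae', hca, h, had', hca'⟩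
      · exact n3 ⟨a, had, ρ, hρ, hda', h⟩
  have hπbd : π.lt b d := by
    refine (π.lt_or_lt_of_ranked v₀ hbd).resolve_right fun h => ?_
    rcases π.lt_or_lt_of_ranked v₀ hb with hbc | hcb'
    · exact n1 ⟨b, hb, π, hπ, hbc, π.ranked_trans h hbc⟩
    · rcases π.lt_or_lt_of_ranked v₀ hbe with hbe' | heb'
      · exact hA ⟨π, hπ, ρ, hρ, d, b, e, c, h, hbe', hcb', heb, hbd', hcb⟩
      · exact n3 ⟨b, hbd, π, hπ, h, heb'⟩
  exact hW ⟨π, hπ, ρ, hρ, v₀, hv₀, a, b, c, π.ranked_trans hπbd hda, hca,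
    ρ.ranked_trans hρae heb, hcb, ha, hb⟩

theorem not_forcedSame_of_forcedSame_of_forcedOpposite (hv₀ : v₀ ∈ E) (hW : ¬ HasWD E)
    (hA : ¬ HasAlpha E) {c d e : C} (hcd : v₀.lt c d) (hde : v₀.lt d e)
    (h1 : ForcedSame E v₀ c d) (h2 : ForcedOpposite E v₀ c e) : ¬ ForcedSame E v₀ d e := by
  intro h3
  obtain ⟨b, hb, π, hπ, hbc, hec⟩ := h2
  rcases π.lt_or_lt_of_ranked v₀ hcd with h | h
  · exact not_forcedOpposite_and_forcedSame hv₀ hW hA hde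
      ⟨c, hcd, π, hπ, h, π.ranked_trans hec h⟩ h3
  · exact not_forcedOpposite_and_forcedSame hv₀ hW hA hcd ⟨b, hb, π, hπ, hbc, h⟩ h1

theorem not_forcedSame_of_forcedOpposite_of_forcedSame (hv₀ : v₀ ∈ E) (hW : ¬ HasWD E)
    (hA : ¬ HasAlpha E) {c d e : C} (hcd : v₀.lt c d) (hde : v₀.lt d e)
    (h1 : ForcedOpposite E v₀ c d) (h2 : ForcedSame E v₀ c e) : ¬ ForcedSame E v₀ d e := by
  intro h3
  obtain ⟨f, hf, ρ, hρ, hcf, hef⟩ := h2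
  have hfd := v₀.ranked_trans hf hcd
  rcases ρ.lt_or_lt_of_ranked v₀ hfd with h | h
  · exact not_forcedOpposite_and_forcedSame hv₀ hW hA hde
      ⟨f, hfd, ρ, hρ, h, ρ.ranked_trans hef h⟩ h3
  · exact not_forcedOpposite_and_forcedSame hv₀ hW hA hcd h1 ⟨f, hf, ρ, hρ, hcf, h⟩

/-- Without forbidden structures, the candidates can be distributed over the two sides of the peak
of `v₀`. -/
theorem exists_sides [Finite C] (hv₀ : v₀ ∈ E) (hW : ¬ HasWD E) (hA : ¬ HasAlpha E) :
    ∃ s : C → Bool, ∀ x y, v₀.lt x y →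
      (ForcedOpposite E v₀ x y → s x ≠ s y) ∧ (ForcedSame E v₀ x y → s x = s y) := by
  obtain ⟨s, hs⟩ := @exists_coloring_of_parity C v₀ _
    (fun x y p => cond p (ForcedOpposite E v₀ x y) (ForcedSame E v₀ x y))
    (by
      intro x y p q hxy hp hq
      have := not_forcedOpposite_and_forcedSame hv₀ hW hA hxy
      cases p <;> cases q <;> simp_all)
    (by
      intro x y z p q hxy hyz _ hq
      have hf : ForcedOpposite E v₀ x z ∨ ForcedSame E v₀ x z := by
        cases q
        · exact .inr hq
        · exact .inl hq
      rcases forced_of_forced hxy hf with h | h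
      · exact ⟨true, h⟩
      · exact ⟨false, h⟩)
    (by
      intro x y z p q r hxy hyz hp hq hr
      cases p <;> cases q <;> cases r <;> simp only [cond_true, cond_false] at hp hq hr <;>
        first
        | rfl
        | exact absurd hr (not_forcedOpposite_triangle hv₀ hW hA hxy hyz hp hq)
        | exact absurd hr
            (not_forcedOpposite_of_forcedSame_of_forcedSame hv₀ hW hA hxy hyz hp hq)
        | exact absurd hr
            (not_forcedSame_of_forcedSame_of_forcedOpposite hv₀ hW hA hxy hyz hp hq)
        | exact absurd hr
            (not_forcedSame_of_forcedOpposite_of_forcedSame hv₀ hW hA hxy hyz hp hq))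
  refine ⟨s, fun x y hxy => ⟨fun h => ?_, fun h => ?_⟩⟩
  · have := hs x y true hxy h
    simp [this]
  · have := hs x y false hxy h
    simpa using this

theorem LinearOrder.exists_rank [Finite C] (v : LinearOrder C) :
    ∃ f : C → ℕ, ∀ x y, v.lt x y → f x < f y := by
  refine ⟨fun x => Set.ncard {y | v.lt y x}, fun x y hxy => ?_⟩
  refine Set.ncard_lt_ncard ?_ (Set.toFinite _)
  refine (Set.ssubset_iff_of_subset fun z hz => v.ranked_trans hz hxy).2 ⟨x, hxy, ?_⟩
  exact fun h => v.ranked_asymm h h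

theorem electionSP_of_not_hasWD_of_not_hasAlpha [Finite C] (hv₀ : v₀ ∈ E) (hW : ¬ HasWD E)
    (hA : ¬ HasAlpha E) : ElectionSP E := by
  obtain ⟨s, hs⟩ := exists_sides hv₀ hW hA
  obtain ⟨f, hf⟩ := v₀.exists_rank
  let g : C → ℤ := fun x => if s x = true then f x + 1 else -(f x + 1)
  have hg : ∀ x, g x = if s x = true then (f x : ℤ) + 1 else -(f x + 1) := fun _ => rfl
  have htri : ∀ x y : C, x ≠ y → v₀.lt x y ∨ v₀.lt y x := fun x y => @lt_or_gt_of_ne C v₀ x y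
  have ginj : Function.Injective g := by
    intro x y hxy
    by_contra hne
    rcases htri x y hne with h | h <;> have := hf _ _ h <;> grind
  have not_between : ∀ a b c : C, g a < g b → g b < g c →
      ∀ v ∈ E, v.lt a b → v.lt c b → False := by
    intro a b c hab hbc v hv h1 h2
    have hneab : a ≠ b := by rintro rfl; exact lt_irrefl _ hab
    have hnebc : b ≠ c := by rintro rfl; exact lt_irrefl _ hbc
    have hneac : a ≠ c := by rintro rfl; exact lt_asymm hab hbc
    have hga := hg a
    have hgb := hg b
    have hgc := hg c
    rcases htri a b hneab with hab' | hba'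
    · have := hf _ _ hab'
      rcases htri b c hnebc with hbc' | hcb'
      · have := hf _ _ hbc'
        have := (hs b c hbc').1 ⟨a, hab', v, hv, h1, h2⟩
        clear h1 h2
        grind
      · have := hf _ _ hcb'
        grind
    · have := hf _ _ hba'
      rcases htri b c hnebc with hbc' | hcb'
      · have := hf _ _ hbc'
        have : s a = s c := by
          rcases htri a c hneac with h | h
          · exact (hs a c h).2 ⟨b, hba', v, hv, h1, h2⟩
          · exact ((hs c a h).2 ⟨b, hbc', v, hv, h2, h1⟩).symm
        clear h1 h2
        grind
      · have := hf _ _ hcb'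
        have := (hs b a hba').1 ⟨c, hcb', v, hv, h2, h1⟩
        clear h1 h2
        grind
  refine ⟨LinearOrder.lift' g ginj, fun v hv a b c hbtw hcb => ?_⟩
  change (g a < g b ∧ g b < g c) ∨ (g c < g b ∧ g b < g a) at hbtw
  have hne : a ≠ b := by
    rintro rfl
    rcases hbtw with h | h
    · exact lt_irrefl _ h.1
    · exact lt_irrefl _ h.2
  refine (@lt_or_gt_of_ne C v a b hne).resolve_left fun hab => ?_
  rcases hbtw with h | h
  · exact not_between a b c h.1 h.2 v hv hab hcb
  · exact not_between c b a h.1 h.2 v hv hcb hab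

theorem SinglePeaked.not_between {ax v : LinearOrder C} (h : SinglePeaked ax v) {a b c : C}
    (hab : v.lt a b) (hcb : v.lt c b) :
    ¬ ((ax.lt a b ∧ ax.lt b c) ∨ (ax.lt c b ∧ ax.lt b a)) :=
  fun hbtw => v.ranked_asymm hab (h a b c hbtw hcb)

theorem not_hasWD_of_electionSP (h : ElectionSP E) : ¬ HasWD E := by
  obtain ⟨ax, hax⟩ := h
  rintro ⟨π, hπ, ρ, hρ, σ, hσ, a, b, c, h1, h2, h3, h4, h5, h6⟩
  have n1 := (hax π hπ).not_between h1 h2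
  have n2 := (hax ρ hρ).not_between h3 h4
  have n3 := (hax σ hσ).not_between h5 h6
  have t1 := ax.lt_or_lt_of_ranked π h1
  have t2 := ax.lt_or_lt_of_ranked π h2
  have t3 := ax.lt_or_lt_of_ranked ρ h4
  tauto

theorem not_hasAlpha_of_electionSP (h : ElectionSP E) : ¬ HasAlpha E := by
  obtain ⟨ax, hax⟩ := h
  rintro ⟨π, hπ, ρ, hρ, a, b, c, d, hab, hbc, hdb, hcb', hba', hdb'⟩
  have hac := π.ranked_trans hab hbc
  have n1 := (hax π hπ).not_between hab hdb
  have n2 := (hax π hπ).not_between hac hbc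
  have n3 := (hax ρ hρ).not_between hcb' hdb'
  have n4 := (hax ρ hρ).not_between (ρ.ranked_trans hcb' hba') hba'
  rcases ax.lt_or_lt_of_ranked π hab with t1 | t1 <;>
    rcases ax.lt_or_lt_of_ranked π hbc with t2 | t2 <;>
    rcases ax.lt_or_lt_of_ranked π hdb with t3 | t3 <;>
    rcases ax.lt_or_lt_of_ranked π hac with t4 | t4 <;>
    simp_all only [and_self, true_or, or_true, not_true_eq_false]

end Forced

/-- Ballester–Haeringer characterization: a finite election is single-peaked
iff it contains neither a worst-diverse structure nor an α-structure. -/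
theorem stmt9 {C : Type*} [Fintype C] (E : Multiset (LinearOrder C)) :
    ElectionSP E ↔ ¬ HasWD E ∧ ¬ HasAlpha E := by
  constructor
  · exact fun h => ⟨not_hasWD_of_electionSP h, not_hasAlpha_of_electionSP h⟩
  · rintro ⟨hW, hA⟩
    rcases E.empty_or_exists_mem with rfl | ⟨v₀, hv₀⟩
    · exact ⟨IsWellOrder.linearOrder WellOrderingRel, by simp⟩
    · exact electionSP_of_not_hasWD_of_not_hasAlpha hv₀ hW hA
end
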